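/- arXiv:2111.14387 — 3 statements merged into one kernel-verified Lean document; each statement's English description precedes it below -/
import Mathlib

section
/- Fix a horizon T ≥ 1, a number of arms n ≥ 2, and an arbitrary reward matrix p ∈ [0,1]^{T×n} (the reward of arm i at round t is p_t(i)). Run the EXP_3 policy with learning rate η = √(log(n)/(T·n)): initialize Ŝ_0(i) = 0 for all i; at each round t, sample the action a_t from the distribution P_t(i) = exp(η·Ŝ_{t-1}(i)) / Σ_{j=1}^n exp(η·Ŝ_{t-1}(j)), observe the reward p_t(a_t), and update Ŝ_t(i) = Ŝ_{t-1}(i) + 1 − 1[a_t = i]·(1 − p_t(a_t))/P_t(i). Then the expected regret satisfies max_{i∈[n]} Σ_{t=1}^T p_t(i) − E[Σ_{t=1}^T p_t(a_t)] ≤ 2·√(T·n·log(n)), where the expectation is over the random action sequence (a_1,…,a_T) whose joint law is the product of the conditional distributions P_t. -/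
/-- The exponential-weighting sampling distribution: given cumulative estimated
rewards `S : Fin n → ℝ` and learning rate `η`, arm `i` is played with probability
`exp(η·S i) / Σ_j exp(η·S j)`. -/
noncomputable def expWeight {n : ℕ} (η : ℝ) (S : Fin n → ℝ) (i : Fin n) : ℝ :=
  Real.exp (η * S i) / ∑ j, Real.exp (η * S j)

/-- The cumulative estimated rewards `Ŝ_t(i)` of EXP_3, as a function of the
realized action sequence `a` (rounds are indexed from `0`, so `Ŝ_t` here is the
state after `t` rounds): `Ŝ_0(i) = 0` and
`Ŝ_{t+1}(i) = Ŝ_t(i) + 1 − 1[a_t = i]·(1 − p_t(a_t))/P_t(i)`,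
where `P_t = expWeight η (Ŝ_t)` is the sampling distribution used at round `t`. -/
noncomputable def exp3S {n : ℕ} (η : ℝ) (p : ℕ → Fin n → ℝ) (a : ℕ → Fin n) :
    ℕ → Fin n → ℝ
  | 0 => fun _ => 0
  | t + 1 => fun i =>
      exp3S η p a t i + 1 -
        (if a t = i then (1 - p t (a t)) / expWeight η (exp3S η p a t) i else 0)

/-- Extend a finite action vector `a : Fin T → Fin n` to all of `ℕ`
(what happens after round `T` is irrelevant). -/
def extAct {T n : ℕ} (hT : 0 < T) (a : Fin T → Fin n) (t : ℕ) : Fin n :=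
  if h : t < T then a ⟨t, h⟩ else a ⟨0, hT⟩

/-- Extend a finite sequence by a default value. -/
def extendBy {α : Type*} {m : ℕ} (d : α) (a : Fin m → α) (t : ℕ) : α :=
  if h : t < m then a ⟨t, h⟩ else d

lemma extendBy_snoc {α : Type*} {m : ℕ} (d : α) (a : Fin m → α) (x : α) :
    extendBy d (Fin.snoc a x : Fin (m + 1) → α) = Function.update (extendBy d a) m x := by
  funext t
  unfold extendBy
  rcases lt_trichotomy t m with h | h | h
  · have h1 : t < m + 1 := by omega
    rw [Function.update_of_ne h.ne, dif_pos h1, dif_pos h]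
    exact Fin.snoc_castSucc (α := fun _ => α) x a ⟨t, h⟩
  · subst h
    rw [Function.update_self, dif_pos (Nat.lt_succ_self t)]
    exact Fin.snoc_last (α := fun _ => α) x a
  · rw [Function.update_of_ne h.ne', dif_neg (by omega), dif_neg (by omega)]

/-- Expectation of `G` over the first `m` actions, drawn from the adapted policy `π`. -/
def pathExp {n : ℕ} (π : (ℕ → Fin n) → ℕ → Fin n → ℝ) (d : Fin n) (m : ℕ)
    (G : (ℕ → Fin n) → ℝ) : ℝ :=
  ∑ a : Fin m → Fin n,
    (∏ t ∈ Finset.range m, π (extendBy d a) t (extendBy d a t)) * G (extendBy d a)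

/-- Conditioning on all actions but the last one. -/
lemma pathExp_succ {n : ℕ} {π : (ℕ → Fin n) → ℕ → Fin n → ℝ}
    (hπ : ∀ a b t, (∀ s < t, a s = b s) → π a t = π b t) (d : Fin n) (m : ℕ)
    (G : (ℕ → Fin n) → ℝ) :
    pathExp π d (m + 1) G =
      pathExp π d m (fun a => ∑ x, π a m x * G (Function.update a m x)) := by
  unfold pathExp
  rw [← (Fin.snocEquiv (fun _ : Fin (m + 1) => Fin n)).sum_comp, Fintype.sum_prod_type_right]
  refine Finset.sum_congr rfl fun a _ => ?_
  rw [Finset.mul_sum]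
  refine Finset.sum_congr rfl fun x _ => ?_
  have hs : (Fin.snocEquiv (fun _ : Fin (m + 1) => Fin n)) (x, a)
      = (Fin.snoc a x : Fin (m + 1) → Fin n) := rfl
  have hupd : ∀ t ≤ m, π (Function.update (extendBy d a) m x) t = π (extendBy d a) t :=
    fun t ht => hπ _ _ _ fun s hs => Function.update_of_ne (by omega) _ _
  rw [hs, extendBy_snoc, Finset.prod_range_succ, Function.update_self, hupd m le_rfl, ← mul_assoc]
  congr 2
  refine Finset.prod_congr rfl fun t ht => ?_
  have ht := Finset.mem_range.1 ht
  rw [hupd t ht.le, Function.update_of_ne ht.ne]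

lemma pathExp_mono {n : ℕ} {π : (ℕ → Fin n) → ℕ → Fin n → ℝ}
    (h0 : ∀ a t x, 0 ≤ π a t x) (d : Fin n) (m : ℕ) {G H : (ℕ → Fin n) → ℝ}
    (h : ∀ a, G a ≤ H a) : pathExp π d m G ≤ pathExp π d m H :=
  Finset.sum_le_sum fun _ _ =>
    mul_le_mul_of_nonneg_left (h _) (Finset.prod_nonneg fun _ _ => h0 _ _ _)

lemma pathExp_const {n : ℕ} {π : (ℕ → Fin n) → ℕ → Fin n → ℝ}
    (hπ : ∀ a b t, (∀ s < t, a s = b s) → π a t = π b t)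
    (h1 : ∀ a t, ∑ x, π a t x = 1) (d : Fin n) (m : ℕ) (c : ℝ) :
    pathExp π d m (fun _ => c) = c := by
  induction m with
  | zero => simp [pathExp]
  | succ m ih =>
    rw [pathExp_succ hπ]
    simp only [← Finset.sum_mul, h1, one_mul, ih]

lemma pathExp_sub_mul {n : ℕ} (π : (ℕ → Fin n) → ℕ → Fin n → ℝ) (d : Fin n) (m : ℕ)
    (c : ℝ) (G H : (ℕ → Fin n) → ℝ) :
    pathExp π d m (fun a => G a - c * H a) = pathExp π d m G - c * pathExp π d m H := by
  simp only [pathExp, mul_sub, Finset.sum_sub_distrib, Finset.mul_sum, mul_left_comm]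

/-- A process that decreases in conditional expectation decreases in expectation. -/
lemma pathExp_le_of_supermartingale {n : ℕ} {π : (ℕ → Fin n) → ℕ → Fin n → ℝ}
    (hπ : ∀ a b t, (∀ s < t, a s = b s) → π a t = π b t)
    (h0 : ∀ a t x, 0 ≤ π a t x) (d : Fin n) (m : ℕ) (Y : ℕ → (ℕ → Fin n) → ℝ)
    (hY : ∀ t < m, ∀ a, ∑ x, π a t x * Y (t + 1) (Function.update a t x) ≤ Y t a) :
    pathExp π d m (Y m) ≤ Y 0 (fun _ => d) := by
  induction m with
  | zero =>
    have hd : ∀ a : Fin 0 → Fin n, extendBy d a = fun _ => d := fun a => by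
      funext t; simp [extendBy]
    simp [pathExp, hd]
  | succ m ih =>
    rw [pathExp_succ hπ]
    exact (pathExp_mono h0 d m (hY m (Nat.lt_succ_self m))).trans
      (ih fun t ht => hY t (ht.trans (Nat.lt_succ_self m)))

lemma expWeight_pos {n : ℕ} (η : ℝ) (S : Fin n → ℝ) (i : Fin n) : 0 < expWeight η S i :=
  div_pos (Real.exp_pos _) (Finset.sum_pos (fun _ _ => Real.exp_pos _) ⟨i, Finset.mem_univ i⟩)

lemma sum_expWeight {n : ℕ} (hn : 0 < n) (η : ℝ) (S : Fin n → ℝ) :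
    ∑ i, expWeight η S i = 1 := by
  unfold expWeight
  rw [← Finset.sum_div]
  exact div_self (Finset.sum_pos (fun _ _ => Real.exp_pos _) ⟨⟨0, hn⟩, Finset.mem_univ _⟩).ne'

lemma exp3S_congr {n : ℕ} (η : ℝ) (p : ℕ → Fin n → ℝ) (a b : ℕ → Fin n) (t : ℕ)
    (h : ∀ s < t, a s = b s) : exp3S η p a t = exp3S η p b t := by
  induction t with
  | zero => rfl
  | succ t ih =>
    funext i
    simp only [exp3S]
    rw [ih fun s hs => h s (hs.trans (Nat.lt_succ_self t)), h t (Nat.lt_succ_self t)]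

lemma exp_neg_le_one_sub_add_sq {x : ℝ} (hx : 0 ≤ x) : Real.exp (-x) ≤ 1 - x + x ^ 2 := by
  have h1 : 1 + x ≤ Real.exp x := by linarith [Real.add_one_le_exp x]
  rw [Real.exp_neg]
  have h2 : (Real.exp x)⁻¹ ≤ (1 + x)⁻¹ := inv_anti₀ (by linarith) h1
  refine h2.trans ?_
  rw [inv_le_iff_one_le_mul₀ (by linarith)]
  nlinarith [pow_nonneg hx 3]

/-- The state of EXP_3 after playing `x` in state `S`, when `x` earns `r x`. -/
noncomputable def exp3Step {n : ℕ} (η : ℝ) (S r : Fin n → ℝ) (x i : Fin n) : ℝ :=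
  S i + 1 - (if x = i then (1 - r x) / expWeight η S i else 0)

/-- Growth of the log-sum-exp potential in one round. -/
lemma log_sum_exp_exp3Step_le {n : ℕ} {η : ℝ} (hη : 0 ≤ η) (S r : Fin n → ℝ) (x : Fin n)
    (hr : r x ∈ Set.Icc (0 : ℝ) 1) :
    Real.log (∑ j, Real.exp (η * exp3Step η S r x j)) ≤
      Real.log (∑ j, Real.exp (η * S j)) + η * r x + η ^ 2 / expWeight η S x := by
  obtain ⟨hr0, hr1⟩ := hr
  set Q := ∑ j, Real.exp (η * S j) with hQ
  have hQ0 : 0 < Q := Finset.sum_pos (fun _ _ => Real.exp_pos _) ⟨x, Finset.mem_univ x⟩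
  set P := expWeight η S x with hP
  have hP0 : 0 < P := expWeight_pos η S x
  have hPQ : Real.exp (η * S x) = P * Q := by
    rw [hP, expWeight, ← hQ]; field_simp
  set u := η * ((1 - r x) / P) with hu
  have hu0 : 0 ≤ u := mul_nonneg hη (div_nonneg (by linarith) hP0.le)
  have hterm : ∀ j, Real.exp (η * exp3Step η S r x j) =
      Real.exp η * (Real.exp (η * S j) +
        if x = j then P * Q * (Real.exp (-u) - 1) else 0) := by
    intro j
    unfold exp3Step
    split_ifs with h
    · subst h
      rw [← hP, ← hPQ]
      have : η * (S x + 1 - (1 - r x) / P) = η + η * S x + -u := by rw [hu]; ring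
      rw [this, Real.exp_add, Real.exp_add]; ring
    · rw [add_zero, ← Real.exp_add]; congr 1; ring
  have hsum : ∑ j, Real.exp (η * exp3Step η S r x j) =
      Real.exp η * (Q * (1 + P * (Real.exp (-u) - 1))) := by
    simp_rw [hterm]
    rw [← Finset.mul_sum, Finset.sum_add_distrib, Finset.sum_ite_eq, if_pos (Finset.mem_univ x)]
    rw [← hQ]; ring
  have hPu : P * u = η * (1 - r x) := by rw [hu]; field_simp
  have hPu2 : P * u ^ 2 ≤ η ^ 2 / P := by
    have : P * u ^ 2 = η ^ 2 / P * (1 - r x) ^ 2 := by rw [hu]; field_simp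
    rw [this]
    exact mul_le_of_le_one_right (by positivity) (by nlinarith)
  have hexp := mul_le_mul_of_nonneg_left (exp_neg_le_one_sub_add_sq hu0) hP0.le
  have hfac : 1 + P * (Real.exp (-u) - 1) ≤ Real.exp (-(η * (1 - r x)) + η ^ 2 / P) := by
    refine le_trans ?_ (Real.add_one_le_exp _)
    nlinarith
  have hpos : 0 < ∑ j, Real.exp (η * exp3Step η S r x j) :=
    Finset.sum_pos (fun _ _ => Real.exp_pos _) ⟨x, Finset.mem_univ x⟩
  rw [Real.log_le_iff_le_exp hpos, hsum]
  have hlast : Real.exp (Real.log Q + η * r x + η ^ 2 / P) =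
      Real.exp η * (Q * Real.exp (-(η * (1 - r x)) + η ^ 2 / P)) := by
    rw [← Real.exp_log hQ0, ← Real.exp_add, ← Real.exp_add, Real.exp_log hQ0]
    congr 1; ring
  rw [hlast]
  gcongr

/-- The importance-weighted estimates are unbiased. -/
lemma sum_expWeight_mul_exp3Step {n : ℕ} (η : ℝ) (S r : Fin n → ℝ) (i : Fin n) :
    ∑ x, expWeight η S x * exp3Step η S r x i = S i + r i := by
  have hP0 := expWeight_pos η S i
  have hterm : ∀ x, expWeight η S x * exp3Step η S r x i =
      expWeight η S x * (S i + 1) - if x = i then 1 - r i else 0 := by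
    intro x
    unfold exp3Step
    split_ifs with h
    · subst h; field_simp
    · ring
  simp_rw [hterm]
  rw [Finset.sum_sub_distrib, ← Finset.sum_mul, sum_expWeight (Fin.pos i), Finset.sum_ite_eq',
    if_pos (Finset.mem_univ i)]
  ring

/-- One-round drift of the potential compared with arm `i`. -/
lemma sum_expWeight_mul_drift_le {n : ℕ} {η : ℝ} (hη : 0 ≤ η) (S r : Fin n → ℝ) (i : Fin n)
    (hr : ∀ x, r x ∈ Set.Icc (0 : ℝ) 1) (c : ℝ) :
    ∑ x, expWeight η S x * (Real.log (∑ j, Real.exp (η * exp3Step η S r x j))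
        - η * exp3Step η S r x i - η * r x + c) ≤
      Real.log (∑ j, Real.exp (η * S j)) - η * (S i + r i) + η ^ 2 * n + c := by
  have hle : ∀ x, expWeight η S x * (Real.log (∑ j, Real.exp (η * exp3Step η S r x j))
        - η * exp3Step η S r x i - η * r x + c) ≤
      expWeight η S x * (Real.log (∑ j, Real.exp (η * S j)) + c)
        - η * (expWeight η S x * exp3Step η S r x i) + η ^ 2 := by
    intro x
    have hP0 := expWeight_pos η S x
    have h := mul_le_mul_of_nonneg_left (log_sum_exp_exp3Step_le hη S r x (hr x)) hP0.le
    have hd : expWeight η S x * (η ^ 2 / expWeight η S x) = η ^ 2 := by field_simp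
    nlinarith
  refine (Finset.sum_le_sum fun x _ => hle x).trans (le_of_eq ?_)
  rw [Finset.sum_add_distrib, Finset.sum_sub_distrib, ← Finset.sum_mul, ← Finset.mul_sum,
    sum_expWeight (Fin.pos i), sum_expWeight_mul_exp3Step, Finset.sum_const, Finset.card_univ,
    Fintype.card_fin, nsmul_eq_mul]
  ring

/-- Regret of EXP_3 against arm `i`, for any learning rate, multiplied by that rate. -/
lemma exp3_regret_le {n : ℕ} (T : ℕ) {η : ℝ} (hη : 0 ≤ η) (p : ℕ → Fin n → ℝ)
    (hp : ∀ t, t < T → ∀ i, p t i ∈ Set.Icc (0 : ℝ) 1) (i d : Fin n) :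
    η * (∑ t ∈ Finset.range T, p t i
      - pathExp (fun a t => expWeight η (exp3S η p a t)) d T
          (fun a => ∑ t ∈ Finset.range T, p t (a t))) ≤
      Real.log n + η ^ 2 * (T * n) := by
  set π : (ℕ → Fin n) → ℕ → Fin n → ℝ := fun a t => expWeight η (exp3S η p a t) with hπdef
  have hπ : ∀ a b t, (∀ s < t, a s = b s) → π a t = π b t := fun a b t h => by
    simp only [hπdef, exp3S_congr η p a b t h]
  have h0 : ∀ a t x, 0 ≤ π a t x := fun a t x => (expWeight_pos _ _ _).le
  have h1 : ∀ a t, ∑ x, π a t x = 1 := fun a t => sum_expWeight (Fin.pos i) _ _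
  let Y : ℕ → (ℕ → Fin n) → ℝ := fun t a =>
    Real.log (∑ j, Real.exp (η * exp3S η p a t j)) - η * exp3S η p a t i
      + η * ∑ s ∈ Finset.range t, (p s i - p s (a s)) - η ^ 2 * (t * n)
  have hY : ∀ t < T, ∀ a, ∑ x, π a t x * Y (t + 1) (Function.update a t x) ≤ Y t a := by
    intro t ht a
    have hS : ∀ x, exp3S η p (Function.update a t x) (t + 1) =
        exp3Step η (exp3S η p a t) (p t) x := by
      intro x
      funext j
      simp only [exp3S, exp3Step, Function.update_self]
      rw [exp3S_congr η p (Function.update a t x) a t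
        fun s hs => Function.update_of_ne hs.ne _ _]
    have hsum : ∀ x, ∑ s ∈ Finset.range (t + 1), (p s i - p s (Function.update a t x s)) =
        ∑ s ∈ Finset.range t, (p s i - p s (a s)) + (p t i - p t x) := by
      intro x
      rw [Finset.sum_range_succ, Function.update_self]
      congr 1
      refine Finset.sum_congr rfl fun s hs => ?_
      rw [Function.update_of_ne (Finset.mem_range.1 hs).ne]
    have h := sum_expWeight_mul_drift_le hη (exp3S η p a t) (p t) i (hp t ht)
      (η * (∑ s ∈ Finset.range t, (p s i - p s (a s)) + p t i) - η ^ 2 * ((t + 1) * n))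
    refine le_trans (le_of_eq (Finset.sum_congr rfl fun x _ => ?_)) (h.trans (le_of_eq ?_))
    · simp only [Y, hπdef, hS, hsum]
      push_cast
      ring
    · simp only [Y]
      ring
  have hmain := pathExp_le_of_supermartingale hπ h0 d T Y hY
  have hY0 : Y 0 (fun _ => d) = Real.log n := by simp [Y, exp3S]
  set c := η * ∑ t ∈ Finset.range T, p t i - η ^ 2 * (T * n) with hc
  have hlow : pathExp π d T (fun a => c - η * ∑ t ∈ Finset.range T, p t (a t)) ≤
      pathExp π d T (Y T) := by
    refine pathExp_mono h0 d T fun a => ?_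
    have hlog : η * exp3S η p a T i ≤ Real.log (∑ j, Real.exp (η * exp3S η p a T j)) := by
      rw [Real.le_log_iff_exp_le
        (Finset.sum_pos (fun _ _ => Real.exp_pos _) ⟨i, Finset.mem_univ i⟩)]
      exact Finset.single_le_sum (f := fun j => Real.exp (η * exp3S η p a T j))
        (fun _ _ => (Real.exp_pos _).le) (Finset.mem_univ i)
    simp only [Y, hc, Finset.sum_sub_distrib]
    linarith
  have hlin : pathExp π d T (fun a => c - η * ∑ t ∈ Finset.range T, p t (a t)) =
      c - η * pathExp π d T (fun a => ∑ t ∈ Finset.range T, p t (a t)) := by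
    rw [pathExp_sub_mul π d T η (fun _ => c), pathExp_const hπ h1]
  rw [hlin] at hlow
  rw [hY0] at hmain
  linarith

/-- for any horizon `T ≥ 1`, `n ≥ 2` arms, and any reward matrix
`p ∈ [0,1]^{T×n}`, the EXP_3 policy with learning rate `η = √(log n / (T·n))`
has expected regret at most `2·√(T·n·log n)`.  The expectation over the random
action sequence `(a_0,…,a_{T−1})` is written explicitly as the sum over all
action sequences, weighted by the product `∏_t P_t(a_t)` of the conditional
sampling probabilities. -/
theorem exp3_revenue_regret_le
    (T n : ℕ) (hT : 1 ≤ T) (hn : 2 ≤ n)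
    (p : ℕ → Fin n → ℝ) (hp : ∀ t, t < T → ∀ i, p t i ∈ Set.Icc (0 : ℝ) 1) :
    let η : ℝ := Real.sqrt (Real.log n / (T * n))
    (Finset.univ.sup' ⟨⟨0, by omega⟩, Finset.mem_univ _⟩
        fun i => ∑ t ∈ Finset.range T, p t i) -
      (∑ a : Fin T → Fin n,
        (∏ t ∈ Finset.range T,
            expWeight η (exp3S η p (extAct hT a) t) (extAct hT a t)) *
          ∑ t ∈ Finset.range T, p t (extAct hT a t))
      ≤ 2 * Real.sqrt (T * n * Real.log n) := by
  intro η
  have hT0 : (0 : ℝ) < T := by exact_mod_cast hT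
  have hn0 : (0 : ℝ) < n := by exact_mod_cast (by omega : 0 < n)
  have hL : 0 < Real.log n := Real.log_pos (by exact_mod_cast (by omega : 1 < n))
  have hη : 0 < η := Real.sqrt_pos.2 (by positivity)
  have hη2 : η ^ 2 * (T * n) = Real.log n := by
    simp only [η]
    rw [Real.sq_sqrt (by positivity)]
    field_simp
  have hηs : η * Real.sqrt (T * n * Real.log n) = Real.log n := by
    simp only [η]
    rw [← Real.sqrt_mul (by positivity)]
    have : Real.log n / (T * n) * (T * n * Real.log n) = Real.log n ^ 2 := by field_simp
    rw [this, Real.sqrt_sq hL.le]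
  have hE : (∑ a : Fin T → Fin n,
        (∏ t ∈ Finset.range T,
            expWeight η (exp3S η p (extAct hT a) t) (extAct hT a t)) *
          ∑ t ∈ Finset.range T, p t (extAct hT a t)) =
      pathExp (fun a t => expWeight η (exp3S η p a t)) ⟨0, by omega⟩ T
        (fun a => ∑ t ∈ Finset.range T, p t (a t)) := by
    refine Finset.sum_congr rfl fun a _ => ?_
    have hext : ∀ t < T, extAct hT a t = extendBy ⟨0, by omega⟩ a t := fun t ht => by
      simp [extAct, extendBy, ht]
    congr 1
    · refine Finset.prod_congr rfl fun t ht => ?_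
      have ht := Finset.mem_range.1 ht
      rw [hext t ht, exp3S_congr η p _ _ t fun s hs => hext s (hs.trans ht)]
    · exact Finset.sum_congr rfl fun t ht => by rw [hext t (Finset.mem_range.1 ht)]
  rw [hE, sub_le_iff_le_add]
  refine Finset.sup'_le _ _ fun i _ => ?_
  rw [← sub_le_iff_le_add]
  refine le_of_mul_le_mul_left ?_ hη
  refine (exp3_regret_le T hη.le p hp i _).trans ?_
  rw [hη2]
  linarith
end

section
/- Let n ≥ 1 agents receive a sequence of T cake pieces with valuations v_t(a) ∈ [0,1], and let (a_1,…,a_T) be the allocation produced by the Allocate-to-Min algorithm, which at round t allocates the piece to an agent minimizing the accumulated valuation AT_a(t−1). For an arbitrary allocation x : {1,…,T} → {1,…,n}, define its fairness F(x) = max_a Σ_{t=1}^T v_t(a)·1[x_t = a] − min_b Σ_{t=1}^T v_t(b)·1[x_t = b]. Then for every allocation x (in particular for the offline-optimal allocation OPT minimizing F), F(Allocate-to-Min) ≤ F(x) + 1; that is, the Fairness Regret F(Allocate-to-Min) − F(OPT) is at most 1. -/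
/-- The accumulated valuations `AT_a(t)` produced by an allocation sequence
`alloc` (rounds indexed from `0`): `AT_a(0) = 0`, and after round `t` the agent
`alloc t` gains `v_t(alloc t)` while all other agents' totals are unchanged. -/
noncomputable def accVal {n : ℕ} (v : ℕ → Fin n → ℝ) (alloc : ℕ → Fin n) :
    ℕ → Fin n → ℝ
  | 0 => fun _ => 0
  | t + 1 => fun a => accVal v alloc t a + (if alloc t = a then v t a else 0)

theorem accVal_eq_sum {n : ℕ} (v : ℕ → Fin n → ℝ) (alloc : ℕ → Fin n) (t : ℕ) (a : Fin n) :
    accVal v alloc t a = ∑ s ∈ Finset.range t, if alloc s = a then v s a else 0 := by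
  induction t with
  | zero => simp [accVal]
  | succ t ih => rw [Finset.sum_range_succ, ← ih, accVal]

/-- Under Allocate-to-Min, accumulated valuations of any two agents differ by at most `1`. -/
theorem accVal_le_accVal_add_one {n T : ℕ} {v : ℕ → Fin n → ℝ}
    (hv : ∀ t a, v t a ∈ Set.Icc (0 : ℝ) 1) {alloc : ℕ → Fin n}
    (hmin : ∀ t, t < T → ∀ b, accVal v alloc t (alloc t) ≤ accVal v alloc t b)
    {t : ℕ} (ht : t ≤ T) (a b : Fin n) :
    accVal v alloc t a ≤ accVal v alloc t b + 1 := by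
  induction t with
  | zero => simp [accVal]
  | succ t ih =>
    have hab := ih (by omega)
    have hb : accVal v alloc t b ≤ accVal v alloc (t + 1) b := by
      simp only [accVal]
      split_ifs
      · linarith [(hv t b).1]
      · linarith
    by_cases h : alloc t = a
    · have hm := hmin t (by omega) b
      rw [h] at hm
      have ha : accVal v alloc (t + 1) a = accVal v alloc t a + v t a := by simp [accVal, h]
      linarith [(hv t a).2]
    · have ha : accVal v alloc (t + 1) a = accVal v alloc t a := by simp [accVal, h]
      linarith

/-- with valuations `v_t(a) ∈ [0,1]`, if `alloc` is an
Allocate-to-Min allocation (at each round `t < T` it picks an agent minimizing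
the accumulated valuation so far), then for every allocation
`x : {1,…,T} → {1,…,n}` — in particular for the offline-optimal one — the
fairness `F(y) = max_a Σ_{t<T} v_t(a)·1[y_t = a] − min_b Σ_{t<T} v_t(b)·1[y_t = b]`
satisfies `F(alloc) ≤ F(x) + 1`; i.e. the Fairness Regret of Allocate-to-Min is
at most `1`. -/
theorem allocate_to_min_fairness_regret_le_one
    (n T : ℕ) (hn : 1 ≤ n)
    (v : ℕ → Fin n → ℝ) (hv : ∀ t a, v t a ∈ Set.Icc (0 : ℝ) 1)
    (alloc : ℕ → Fin n)
    (hmin : ∀ t, t < T → ∀ b, accVal v alloc t (alloc t) ≤ accVal v alloc t b)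
    (x : ℕ → Fin n) :
    let F : (ℕ → Fin n) → ℝ := fun y =>
      Finset.univ.sup' ⟨⟨0, by omega⟩, Finset.mem_univ _⟩
          (fun a => ∑ t ∈ Finset.range T, if y t = a then v t a else 0) -
        Finset.univ.inf' ⟨⟨0, by omega⟩, Finset.mem_univ _⟩
          (fun b => ∑ t ∈ Finset.range T, if y t = b then v t b else 0)
    F alloc ≤ F x + 1 := by
  intro F
  have hx : 0 ≤ F x := sub_nonneg.2 <|
    (Finset.inf'_le _ (Finset.mem_univ (⟨0, by omega⟩ : Fin n))).trans
      (Finset.le_sup' (fun a => ∑ t ∈ Finset.range T, if x t = a then v t a else 0)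
        (Finset.mem_univ _))
  have ha : F alloc ≤ 1 := by
    rw [sub_le_iff_le_add']
    refine Finset.sup'_le _ _ fun a _ => ?_
    rw [← sub_le_iff_le_add]
    refine Finset.le_inf' _ _ fun b _ => ?_
    rw [sub_le_iff_le_add, ← accVal_eq_sum, ← accVal_eq_sum]
    exact accVal_le_accVal_add_one hv hmin le_rfl a b
  linarith
end

section
/- Let n ≥ 2 and T ≥ 1, and consider the valuation sequence v_t(a) with v_t(1) = 1 and v_t(a) = 0 for all a ≠ 1 and all t ∈ {1,…,T}. Let μ be any probability distribution over allocations x : {1,…,T} → {1,…,n} (encoding an arbitrary randomized online policy). Define the Revenue Regret RevR = max_{i} Σ_{t=1}^T v_t(i) − E_μ[Σ_{t=1}^T v_t(x_t)] and the Fairness Regret FairR = E_μ[F(x)] − min_{y} F(y), where F(y) = max_a Σ_t v_t(a)·1[y_t = a] − min_b Σ_t v_t(b)·1[y_t = b]. Then min_y F(y) = 0 and RevR + FairR = T; in particular max(RevR, FairR) ≥ T/2, so no algorithm achieves sub-linear Revenue Regret and sub-linear Fairness Regret simultaneously on this instance. -/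
/-- impossibility of simultaneous sub-linear Revenue and Fairness
Regret.  On the instance where agent `1` (here the agent `0 : Fin n`) values every
piece at `1` and all other agents value every piece at `0`, for any probability
distribution `μ` over allocations `x : {1,…,T} → {1,…,n}` (i.e. any randomized
policy): the optimal offline fairness is `0`, `RevR + FairR = T`, and hence
`max(RevR, FairR) ≥ T/2`. -/
theorem revenue_fairness_impossibility
    (n T : ℕ) (hn : 2 ≤ n) (hT : 1 ≤ T)
    (μ : (Fin T → Fin n) → ℝ) (hμ0 : ∀ x, 0 ≤ μ x) (hμ1 : ∑ x, μ x = 1) :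
    let v : Fin T → Fin n → ℝ := fun _ a => if (a : ℕ) = 0 then 1 else 0
    let F : (Fin T → Fin n) → ℝ := fun y =>
      Finset.univ.sup' ⟨⟨0, by omega⟩, Finset.mem_univ _⟩
          (fun a => ∑ t, if y t = a then v t a else 0) -
        Finset.univ.inf' ⟨⟨0, by omega⟩, Finset.mem_univ _⟩
          (fun b => ∑ t, if y t = b then v t b else 0)
    let optF : ℝ :=
      Finset.univ.inf' ⟨fun _ => ⟨0, by omega⟩, Finset.mem_univ _⟩ F
    let RevR : ℝ :=
      (Finset.univ.sup' ⟨⟨0, by omega⟩, Finset.mem_univ _⟩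
          fun i => ∑ t, v t i) -
        ∑ x, μ x * ∑ t, v t (x t)
    let FairR : ℝ := (∑ x, μ x * F x) - optF
    optF = 0 ∧ RevR + FairR = T ∧ (T : ℝ) / 2 ≤ max RevR FairR := by
  intro v F optF RevR FairR
  have v_nonneg : ∀ t a, 0 ≤ v t a := fun t a => by
    simp only [v]; split_ifs <;> norm_num
  have v_le_one : ∀ t a, v t a ≤ 1 := fun t a => by
    simp only [v]; split_ifs <;> norm_num
  have share_nonneg : ∀ (y : Fin T → Fin n) (b : Fin n),
      0 ≤ ∑ t, if y t = b then v t b else 0 := fun y b =>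
    Finset.sum_nonneg fun t _ => by
      split_ifs
      exacts [v_nonneg t b, le_rfl]
  have F_eq : ∀ y, F y = ∑ t, v t (y t) := fun y => by
    have hmax : Finset.univ.sup' ⟨⟨0, by omega⟩, Finset.mem_univ _⟩
        (fun a => ∑ t, if y t = a then v t a else 0) = ∑ t, v t (y t) := by
      apply le_antisymm
      · refine Finset.sup'_le _ _ fun a _ => Finset.sum_le_sum fun t _ => ?_
        split_ifs with h
        exacts [h ▸ le_rfl, v_nonneg t (y t)]
      · refine le_trans (Finset.sum_le_sum fun t _ => ?_) (Finset.le_sup'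
          (fun a => ∑ t, if y t = a then v t a else 0)
          (Finset.mem_univ (⟨0, by omega⟩ : Fin n)))
        simp [v, Fin.ext_iff]
    have hmin : Finset.univ.inf' ⟨⟨0, by omega⟩, Finset.mem_univ _⟩
        (fun b => ∑ t, if y t = b then v t b else 0) = 0 := by
      apply le_antisymm
      · refine le_trans (Finset.inf'_le (fun b => ∑ t, if y t = b then v t b else 0)
          (Finset.mem_univ (⟨1, by omega⟩ : Fin n))) ?_
        simp [v]
      · exact Finset.le_inf' _ _ fun b _ => share_nonneg y b
    simp only [F]
    rw [hmax, hmin, sub_zero]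
  have optF_eq : optF = 0 := by
    apply le_antisymm
    · refine le_trans (Finset.inf'_le F
        (Finset.mem_univ (fun _ => (⟨1, by omega⟩ : Fin n)))) ?_
      rw [F_eq]
      simp [v]
    · refine Finset.le_inf' _ _ fun y _ => ?_
      rw [F_eq]
      exact Finset.sum_nonneg fun t _ => v_nonneg t (y t)
  have best_eq : (Finset.univ.sup' ⟨⟨0, by omega⟩, Finset.mem_univ _⟩
      fun i => ∑ t, v t i) = (T : ℝ) := by
    apply le_antisymm
    · refine Finset.sup'_le _ _ fun a _ =>
        (Finset.sum_le_sum fun t _ => v_le_one t a).trans ?_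
      simp
    · refine le_trans ?_ (Finset.le_sup' (fun i => ∑ t, v t i)
        (Finset.mem_univ (⟨0, by omega⟩ : Fin n)))
      simp [v]
  have regret_sum : RevR + FairR = T := by
    simp only [RevR, FairR]
    rw [best_eq, optF_eq]
    simp only [F_eq]
    ring
  refine ⟨optF_eq, regret_sum, ?_⟩
  linarith [le_max_left RevR FairR, le_max_right RevR FairR]
end
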